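/- arXiv:1311.4046 — 5 statements merged into one kernel-verified Lean document; each statement's English description precedes it below -/
import Mathlib

section
/- Let h ∈ MvPolynomial (Fin n) ℝ be a guard polynomial and let f : Fin n → MvPolynomial (Fin n) ℝ be update polynomials. In MvPolynomial (Fin n ⊕ Fin n) ℝ consider the set of generators G consisting of rename Sum.inl h together with the polynomials rename Sum.inr (X i) − rename Sum.inl (f i) for each i : Fin n. Let σ : MvPolynomial (Fin n ⊕ Fin n) ℝ → MvPolynomial (Fin n) ℝ be the substitution homomorphism sending the unprimed variable inl j to X j and the primed variable inr i to f i (i.e., aeval (Sum.elim X f)). Then for every p ∈ MvPolynomial (Fin n ⊕ Fin n) ℝ, p lies in the ideal generated by G if and only if σ(p) lies in the ideal generated by {h} in MvPolynomial (Fin n) ℝ. (In particular, when h = 0, p ∈ ⟨{rename inr (X i) − rename inl (f i) : i}⟩ iff the substitution σ(p) is the zero polynomial; this captures that for a deterministic transition with unit denominators, division by the Gröbner basis of the transition ideal coincides with substitution of the primed variables by the updates.) -/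
open MvPolynomial

/-- Modulo an ideal containing every `X (inr i) - rename inl (f i)`, a polynomial equals the result
of substituting `f i` for `X (inr i)`. -/
theorem sub_rename_inl_aeval_mem {R σ τ : Type*} [CommRing R] (f : τ → MvPolynomial σ R)
    (I : Ideal (MvPolynomial (σ ⊕ τ) R))
    (hI : ∀ i, X (Sum.inr i) - rename Sum.inl (f i) ∈ I) (p : MvPolynomial (σ ⊕ τ) R) :
    p - rename Sum.inl (aeval (Sum.elim X f) p) ∈ I := by
  have key : Ideal.Quotient.mkₐ R I =
      ((Ideal.Quotient.mkₐ R I).comp (rename Sum.inl)).comp (aeval (Sum.elim X f)) := by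
    refine MvPolynomial.algHom_ext fun i => ?_
    rcases i with j | i
    · simp
    · simpa using Ideal.Quotient.eq.mpr (hI i)
  exact Ideal.Quotient.eq.mp (DFunLike.congr_fun key p)

theorem deterministic_transition_groebner (n : ℕ)
    (h : MvPolynomial (Fin n) ℝ) (f : Fin n → MvPolynomial (Fin n) ℝ)
    (p : MvPolynomial (Fin n ⊕ Fin n) ℝ) :
    p ∈ Ideal.span (insert (rename Sum.inl h)
        {g | ∃ i : Fin n, g = rename Sum.inr (X i) - rename Sum.inl (f i)}) ↔
      MvPolynomial.aeval (Sum.elim X f) p ∈ Ideal.span {h} := by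
  have aeval_inl (q : MvPolynomial (Fin n) ℝ) :
      aeval (Sum.elim X f) (rename Sum.inl q : MvPolynomial (Fin n ⊕ Fin n) ℝ) = q := by
    rw [aeval_rename, Sum.elim_comp_inl, aeval_X_left_apply]
  constructor
  · intro hp
    refine Ideal.mem_comap.mp ((Ideal.span_le (I := (Ideal.span {h}).comap
      (aeval (Sum.elim X f)))).mpr ?_ hp)
    rintro g (rfl | ⟨i, rfl⟩)
    · simp only [SetLike.mem_coe, Ideal.mem_comap, aeval_inl]
      exact Ideal.mem_span_singleton_self h
    · simp only [SetLike.mem_coe, Ideal.mem_comap, map_sub, aeval_inl, rename_X, aeval_X,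
        Sum.elim_inr, sub_self, zero_mem]
  · intro hp
    obtain ⟨q, hq⟩ := Ideal.mem_span_singleton.mp hp
    refine (Submodule.sub_mem_iff_left _ (y := rename Sum.inl (aeval (Sum.elim X f) p)) ?_).mp
      (sub_rename_inl_aeval_mem f _ (fun i => Ideal.subset_span (Or.inr ⟨i, by simp⟩)) p)
    rw [hq, map_mul]
    exact Ideal.mul_mem_right _ _ (Ideal.subset_span (Set.mem_insert _ _))
end

section
/- (Soundness of the invariance condition.) Let stem and exit be sets of polynomials in MvPolynomial (Fin n) ℝ and let T be a finite set of transitions, each transition τ ∈ T being a set of polynomials in MvPolynomial (Fin n ⊕ Fin n) ℝ. Let p, s ∈ MvPolynomial (Fin n) ℝ and d ∈ ℕ, and for each τ ∈ T let q_τ, Φ_τ ∈ MvPolynomial (Fin n) ℝ. Assume: (i) p ∈ ⟨stem⟩; (ii) for each τ ∈ T, the polynomial rename Sum.inl (q_τ^d · s) · rename Sum.inr p − rename Sum.inl (Φ_τ · p) lies in ⟨τ⟩ (the ideal in MvPolynomial (Fin n ⊕ Fin n) ℝ generated by τ); (iii) for every valuation ν : Fin n → ℝ not satisfying exit, both q_τ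 (for each τ ∈ T) and s evaluate to nonzero values at ν. Then p is an inductive invariant of the lasso program L = (V, stem, T, exit): every valuation satisfying stem makes p vanish, and for every τ ∈ T and all valuations ν, ν' : Fin n → ℝ, if p evaluates to 0 at ν, all polynomials of τ vanish at the combined valuation Sum.elim ν ν', and ν does not satisfy exit, then p evaluates to 0 at ν'. -/
open MvPolynomial

/-- A polynomial in the ideal generated by `P` vanishes at every common zero of `P`. -/
theorem MvPolynomial.eval_eq_zero_of_mem_span {σ R : Type*} [CommRing R]
    {P : Set (MvPolynomial σ R)} {f : MvPolynomial σ R} (hf : f ∈ Ideal.span P)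
    {x : σ → R} (hx : ∀ g ∈ P, eval x g = 0) : eval x f = 0 :=
  (Ideal.span_le (I := RingHom.ker (eval x))).2 hx hf

theorem invariance_condition_soundness (n : ℕ)
    (stem exitA : Set (MvPolynomial (Fin n) ℝ))
    (T : Set (Set (MvPolynomial (Fin n ⊕ Fin n) ℝ))) (hT : T.Finite)
    (p s : MvPolynomial (Fin n) ℝ) (d : ℕ)
    (q Φ : Set (MvPolynomial (Fin n ⊕ Fin n) ℝ) → MvPolynomial (Fin n) ℝ)
    (h1 : p ∈ Ideal.span stem)
    (h2 : ∀ τ ∈ T,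
      rename Sum.inl ((q τ) ^ d * s) * rename Sum.inr p
        - rename Sum.inl (Φ τ * p) ∈ Ideal.span τ)
    (h3 : ∀ ν : Fin n → ℝ, ¬ (∀ g ∈ exitA, eval ν g = 0) →
      (∀ τ ∈ T, eval ν (q τ) ≠ 0) ∧ eval ν s ≠ 0) :
    (∀ ν : Fin n → ℝ, (∀ g ∈ stem, eval ν g = 0) → eval ν p = 0) ∧
    (∀ τ ∈ T, ∀ ν ν' : Fin n → ℝ, eval ν p = 0 →
      (∀ g ∈ τ, eval (Sum.elim ν ν') g = 0) →
      ¬ (∀ g ∈ exitA, eval ν g = 0) → eval ν' p = 0) := by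
  refine ⟨fun ν hν => eval_eq_zero_of_mem_span h1 hν, fun τ hτ ν ν' hp hstep hexit => ?_⟩
  obtain ⟨hq, hs⟩ := h3 ν hexit
  have h := eval_eq_zero_of_mem_span (h2 τ hτ) hstep
  simp only [map_sub, map_mul, map_pow, eval_rename, Sum.elim_comp_inl, Sum.elim_comp_inr, hp,
    mul_zero, sub_zero] at h
  exact (mul_eq_zero.1 h).resolve_left (mul_ne_zero (pow_ne_zero d (hq τ hτ)) hs)
end

section
/- (Completeness over ℂ for guard-free deterministic transitions with unit denominators.) Let stem be a set of polynomials in MvPolynomial (Fin n) ℂ, let s, p ∈ MvPolynomial (Fin n) ℂ, and let f : Fin n → MvPolynomial (Fin n) ℂ be the update polynomials of a deterministic transition x_i' = f_i(V). Assume: (i) the ideal ⟨stem⟩ is a radical ideal and the principal ideal ⟨p⟩ is a radical ideal; (ii) p is a complex invariant: every valuation ν : Fin n → ℂ at which all polynomials of stem vanish satisfies p(ν) = 0, and for every valuation ν : Fin n → ℂ with p(ν) = 0 and s(ν) ≠ 0, p vanishes at the updated valuation (fun i => eval ν (f i)). Then p ∈ ⟨stem⟩, and there exists a polynomial Φ ∈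 MvPolynomial (Fin n) ℂ such that s · (aeval f p) = Φ · p, where aeval f p denotes the result of substituting f i for the i-th variable of p (i.e., the invariance condition is satisfiable with this p). -/
open MvPolynomial

/-- A polynomial vanishing on the common zeros of `S` lies in the span of `S`, if that span is
a radical ideal. -/
theorem mem_span_of_isRadical_of_forall_eval_eq_zero {K σ : Type*} [Field K] [IsAlgClosed K]
    [Finite σ] {S : Set (MvPolynomial σ K)} (hS : (Ideal.span S).IsRadical)
    {q : MvPolynomial σ K} (hq : ∀ ν : σ → K, (∀ g ∈ S, eval ν g = 0) → eval ν q = 0) :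
    q ∈ Ideal.span S := by
  rw [← hS.radical, ← vanishingIdeal_zeroLocus_eq_radical (K := K), zeroLocus_span]
  intro ν hν
  simp only [Set.mem_ofPred_eq, aeval_eq_eval] at hν ⊢
  exact hq ν hν

theorem eval_aeval_eq_eval {R σ τ : Type*} [CommSemiring R] (f : σ → MvPolynomial τ R)
    (p : MvPolynomial σ R) (ν : τ → R) :
    eval ν (aeval f p) = eval (fun i => eval ν (f i)) p := by
  simp only [← coe_aeval_eq_eval, RingHom.coe_coe]
  exact comp_aeval_apply f (aeval ν) p

theorem completeness_over_C (n : ℕ) (stem : Set (MvPolynomial (Fin n) ℂ))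
    (s p : MvPolynomial (Fin n) ℂ) (f : Fin n → MvPolynomial (Fin n) ℂ)
    (hradstem : (Ideal.span stem).IsRadical)
    (hradp : (Ideal.span {p}).IsRadical)
    (hinit : ∀ ν : Fin n → ℂ, (∀ g ∈ stem, eval ν g = 0) → eval ν p = 0)
    (hcons : ∀ ν : Fin n → ℂ, eval ν p = 0 → eval ν s ≠ 0 →
      eval (fun i => eval ν (f i)) p = 0) :
    p ∈ Ideal.span stem ∧
    ∃ Φ : MvPolynomial (Fin n) ℂ, s * MvPolynomial.aeval f p = Φ * p := by
  refine ⟨mem_span_of_isRadical_of_forall_eval_eq_zero hradstem hinit, ?_⟩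
  have hmem : s * aeval f p ∈ Ideal.span {p} := by
    refine mem_span_of_isRadical_of_forall_eval_eq_zero hradp fun ν hν => ?_
    rw [map_mul, eval_aeval_eq_eval, mul_eq_zero, or_iff_not_imp_left]
    exact hcons ν (hν p rfl)
  obtain ⟨Φ, hΦ⟩ := Ideal.mem_span_singleton'.mp hmem
  exact ⟨Φ, hΦ.symm⟩
end

section
/- (Core of the finite-test-cases theorem.) Let (P_i)_{i ∈ ℕ} be a sequence of finite sets of polynomials in MvPolynomial (Fin m) ℝ (the algebraic constraints induced by an infinite family of test cases on the synthesis variables). Then there exists k ∈ ℕ such that for every valuation β : Fin m → ℝ, if β is a common zero of all polynomials in P_0 ∪ P_1 ∪ … ∪ P_k, then β is a common zero of all polynomials in P_i for every i ∈ ℕ. (Consequently, finitely many test cases suffice to enforce the same constraint on the synthesis variables as all infinitely many test cases.) -/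
open MvPolynomial

theorem finitely_many_test_cases_suffice (m : ℕ)
    (P : ℕ → Finset (MvPolynomial (Fin m) ℝ)) :
    ∃ k : ℕ, ∀ β : Fin m → ℝ,
      (∀ i ≤ k, ∀ q ∈ P i, eval β q = 0) →
      ∀ i : ℕ, ∀ q ∈ P i, eval β q = 0 := by
  let I : ℕ →o Ideal (MvPolynomial (Fin m) ℝ) :=
    { toFun := fun k => Ideal.span {q | ∃ i ≤ k, q ∈ P i}
      monotone' := fun a b hab =>
        Ideal.span_mono fun _ ⟨i, hi, hq⟩ => ⟨i, hi.trans hab, hq⟩ }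
  obtain ⟨k, hk⟩ := monotone_stabilizes_iff_noetherian.mpr inferInstance I
  refine ⟨k, fun β hβ i q hq => ?_⟩
  have hle : I k ≤ RingHom.ker (eval β) :=
    Ideal.span_le.mpr fun p ⟨j, hj, hp⟩ => hβ j hj p hp
  have hmem : q ∈ I (max k i) := Ideal.subset_span ⟨i, le_max_right k i, hq⟩
  rw [← hk _ (le_max_left k i)] at hmem
  exact hle hmem
end

section
/- (Denominator clearing eliminates primed variables.) Let f, g : Fin n → MvPolynomial (Fin n) ℝ be the numerators and denominators of the updates x_i'·g_i(V) − f_i(V) of a deterministic transition, let q ∈ MvPolynomial (Fin n) ℝ be a common multiple of all the g_i (e.g., their product, so that for each i there is u_i with q = u_i · g_i), and let p ∈ MvPolynomial (Fin n) ℝ have total degree at most d. Then there exists a polynomial r ∈ MvPolynomial (Fin n) ℝ in the unprimed variables only such that rename Sum.inl (q^d) · rename Sum.inr p − rename Sum.inl r lies in the ideal of MvPolynomial (Fin n ⊕ Fin n) ℝ generated by the update polynomials rename Sum.inr (X i) · rename Sum.inl (g i) − rename Sum.inl (f i) for i : Fin n. -/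
open MvPolynomial

/-- If multiplying each `y i` by `φ q` lands in the range of `φ`, then so does multiplying
`aeval y p` by `φ (q ^ d)`, for every `p` of total degree at most `d`. -/
theorem MvPolynomial.pow_mul_aeval_mem_range {σ R A B : Type*} [CommSemiring R]
    [CommSemiring A] [Algebra R A] [CommSemiring B] [Algebra R B] (φ : A →ₐ[R] B)
    (y : σ → B) (q : A) (h : ∀ i, φ q * y i ∈ φ.range) (p : MvPolynomial σ R) (d : ℕ)
    (hd : p.totalDegree ≤ d) : φ (q ^ d) * aeval y p ∈ φ.range := by
  rw [aeval_def, eval₂_eq, Finset.mul_sum]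
  refine Subalgebra.sum_mem _ fun s hs => ?_
  have hsd : ∑ i ∈ s.support, s i ≤ d := (le_totalDegree hs).trans hd
  have key : φ (q ^ d) * (algebraMap R B (p.coeff s) * ∏ i ∈ s.support, y i ^ s i) =
      algebraMap R B (p.coeff s) * φ (q ^ (d - ∑ i ∈ s.support, s i)) *
        ∏ i ∈ s.support, (φ q * y i) ^ s i := by
    simp only [mul_pow, Finset.prod_mul_distrib, Finset.prod_pow_eq_pow_sum, map_pow]
    rw [← Nat.sub_add_cancel hsd, pow_add, Nat.add_sub_cancel]
    ring
  rw [key]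
  exact mul_mem (mul_mem (Subalgebra.algebraMap_mem _ _) ⟨_, rfl⟩)
    (Subalgebra.prod_mem _ fun i _ => pow_mem (h i) _)

theorem denominator_clearing_eliminates_primed_variables (n : ℕ)
    (f g : Fin n → MvPolynomial (Fin n) ℝ)
    (q : MvPolynomial (Fin n) ℝ)
    (hq : ∀ i : Fin n, ∃ u : MvPolynomial (Fin n) ℝ, q = u * g i)
    (p : MvPolynomial (Fin n) ℝ) (d : ℕ) (hd : p.totalDegree ≤ d) :
    ∃ r : MvPolynomial (Fin n) ℝ,
      rename Sum.inl (q ^ d) * rename Sum.inr p - rename Sum.inl r ∈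
        Ideal.span {w : MvPolynomial (Fin n ⊕ Fin n) ℝ |
          ∃ i : Fin n, w = rename Sum.inr (X i) * rename Sum.inl (g i)
            - rename Sum.inl (f i)} := by
  set I := Ideal.span {w : MvPolynomial (Fin n ⊕ Fin n) ℝ |
    ∃ i : Fin n, w = rename Sum.inr (X i) * rename Sum.inl (g i) - rename Sum.inl (f i)}
  let π : MvPolynomial (Fin n ⊕ Fin n) ℝ →ₐ[ℝ] _ := Ideal.Quotient.mkₐ ℝ I
  let φ := π.comp (rename (Sum.inl : Fin n → Fin n ⊕ Fin n))
  have hy : ∀ i, φ q * π (X (Sum.inr i)) ∈ φ.range := by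
    intro i
    obtain ⟨u, hu⟩ := hq i
    have hi : π (X (Sum.inr i)) * φ (g i) = φ (f i) := by
      refine Ideal.Quotient.eq.mpr (Ideal.subset_span ⟨i, ?_⟩)
      rw [rename_X]
      rfl
    refine φ.mem_range.mpr ⟨u * f i, ?_⟩
    rw [map_mul, ← hi, hu, map_mul]
    ring
  obtain ⟨r, hr⟩ := pow_mul_aeval_mem_range φ (fun i => π (X (Sum.inr i))) q hy p d hd
  have hp : aeval (fun i => π (X (Sum.inr i))) p = π (rename Sum.inr p) := by
    rw [← AlgHom.comp_apply]
    congr 1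
    ext i
    simp
  refine ⟨r, Ideal.Quotient.eq.mp ?_⟩
  rw [hp] at hr
  exact (map_mul π _ _).trans hr.symm
end
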